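/- Let V be a finite type, G a simple graph on V in which every vertex has at least one neighbor, T a complete linear order, and let (e, n) be the weights of a flooding graph: e : V → V → T is a symmetric edge-weight function and n : V → T a node-weight function with e i j = n i ⊔ n j for all adjacent i, j, and n i equal to the infimum of e i j over the neighbors j of i, for all i. Then the node-weighted graph and the edge-weighted graph have the same regional minima: a vertex v belongs to a regional minimum of the node weights n if and only if v is an endpoint of some adjacent pair lying in a regional minimum of the edge weights e. -/

import Mathlib

/-- A vertex `i` belongs to a regional minimum of node weights `n`. -/
def NodeRegMin {V : Type*} {T : Type*} [LinearOrder T] (G : SimpleGraph V)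
    (n : V → T) (i : V) : Prop :=
  ∀ v : V, (∃ p : G.Walk i v, ∀ x ∈ p.support, n x = n i) →
    ∀ w, G.Adj v w → n i ≤ n w

/-- An adjacent pair `{i, j}` belongs to a regional minimum of edge weights `e`. -/
def EdgeRegMin {V : Type*} {T : Type*} [LinearOrder T] (G : SimpleGraph V)
    (e : V → V → T) (i j : V) : Prop :=
  G.Adj i j ∧
    ∀ v : V, (∃ p : G.Walk i v, ∀ d ∈ p.darts, e d.fst d.snd = e i j) →
      ∀ w, G.Adj v w → e i j ≤ e v w

section RegionalMinima

variable {V T : Type*} {G : SimpleGraph V}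

theorem NodeRegMin.of_adj [LinearOrder T] {n : V → T} {a b : V} (h : NodeRegMin G n a)
    (hab : G.Adj a b) (hn : n b = n a) : NodeRegMin G n b := by
  rintro u ⟨p, hp⟩ w hw
  rw [hn]
  refine h u ⟨SimpleGraph.Walk.cons hab p, fun x hx => ?_⟩ w hw
  rw [SimpleGraph.Walk.support_cons, List.mem_cons] at hx
  rcases hx with rfl | hx
  · rfl
  · rw [hp x hx, hn]

theorem NodeRegMin.eq_of_walk [LinearOrder T] {n : V → T} {e : V → V → T}
    (hde : ∀ i j, G.Adj i j → e i j = n i ⊔ n j) {a u : V} (p : G.Walk a u)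
    (h : NodeRegMin G n a) (hp : ∀ d ∈ p.darts, e d.fst d.snd = n a) : n u = n a := by
  induction p with
  | nil => rfl
  | @cons a b u hab p ih =>
    simp only [SimpleGraph.Walk.darts_cons, List.mem_cons, forall_eq_or_imp] at hp
    have hle : n b ≤ n a := by
      have hedge := hp.1
      rw [hde a b hab] at hedge
      exact sup_eq_left.mp hedge
    have hge : n a ≤ n b := h a ⟨.nil, by simp⟩ b hab
    have hba : n b = n a := le_antisymm hle hge
    rw [← hba]
    exact ih (h.of_adj hab hba) (by rw [hba]; exact hp.2)

theorem EdgeRegMin.symm [LinearOrder T] {e : V → V → T} (hsym : ∀ i j, e i j = e j i)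
    {i j : V} (h : EdgeRegMin G e i j) : EdgeRegMin G e j i := by
  refine ⟨h.1.symm, ?_⟩
  rintro v ⟨p, hp⟩ w hw
  rw [hsym j i] at hp ⊢
  refine h.2 v ⟨SimpleGraph.Walk.cons h.1 p, ?_⟩ w hw
  simpa using hp

theorem walk_darts_eq_of_support_eq [LinearOrder T] {n : V → T} {e : V → V → T}
    (hde : ∀ i j, G.Adj i j → e i j = n i ⊔ n j) {a u : V} (p : G.Walk a u) {c : T}
    (hp : ∀ x ∈ p.support, n x = c) : ∀ d ∈ p.darts, e d.fst d.snd = c := by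
  intro d hd
  rw [hde _ _ d.adj, hp _ (p.dart_fst_mem_support_of_mem_darts hd),
    hp _ (p.dart_snd_mem_support_of_mem_darts hd), sup_idem]

theorem EdgeRegMin.nodeRegMin [CompleteLinearOrder T] {n : V → T} {e : V → V → T}
    (hde : ∀ i j, G.Adj i j → e i j = n i ⊔ n j)
    (hen : ∀ i, n i = ⨅ j, ⨅ _ : G.Adj i j, e i j) {i j : V} (h : EdgeRegMin G e i j) :
    NodeRegMin G n i := by
  have hle : ∀ v : V, (∃ p : G.Walk i v, ∀ d ∈ p.darts, e d.fst d.snd = e i j) →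
      e i j ≤ n v := fun v hv => by
    rw [hen v]
    exact le_iInf₂ (h.2 v hv)
  have hi : n i = e i j :=
    le_antisymm (by rw [hde i j h.1]; exact le_sup_left) (hle i ⟨.nil, by simp⟩)
  rintro u ⟨p, hp⟩ w hw
  have hu : n u = n i := hp u p.end_mem_support
  have hd := walk_darts_eq_of_support_eq hde p hp
  by_contra! hlt
  refine hlt.not_ge (hi.trans_le (hle w ⟨p.concat hw, fun d hdm => ?_⟩))
  rw [SimpleGraph.Walk.darts_concat, List.concat_eq_append, List.mem_append,
    List.mem_singleton] at hdm
  rcases hdm with hdm | rfl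
  · rw [hd d hdm, hi]
  · rw [hde _ _ hw, hu, sup_eq_left.mpr hlt.le, hi]

theorem exists_adj_eq_iInf [Finite V] [CompleteLinearOrder T] (f : V → T) {i : V}
    (hi : ∃ j, G.Adj i j) : ∃ j, G.Adj i j ∧ f j = ⨅ j, ⨅ _ : G.Adj i j, f j := by
  obtain ⟨k, hk⟩ := hi
  have : Nonempty {j // G.Adj i j} := ⟨⟨k, hk⟩⟩
  obtain ⟨⟨j, hj⟩, h⟩ := exists_eq_ciInf_of_finite (f := fun j : {j // G.Adj i j} => f j)
  exact ⟨j, hj, h.trans iInf_subtype⟩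

end RegionalMinima

/-- in a flooding graph (`δ_en n = e` and `ε_ne e = n`), the node
weighted graph and the edge weighted graph have the same regional minima. -/
theorem flooding_graph_same_regional_minima {V : Type*} [Fintype V]
    (G : SimpleGraph V) (hnb : ∀ i : V, ∃ j, G.Adj i j) {T : Type*}
    [CompleteLinearOrder T] (e : V → V → T) (hsym : ∀ i j, e i j = e j i)
    (n : V → T) (hde : ∀ i j, G.Adj i j → e i j = n i ⊔ n j)
    (hen : ∀ i, n i = ⨅ j, ⨅ _ : G.Adj i j, e i j) (v : V) :
    NodeRegMin G n v ↔ ∃ i j, EdgeRegMin G e i j ∧ (v = i ∨ v = j) := by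
  constructor
  · intro h
    obtain ⟨j, hj, hej⟩ := exists_adj_eq_iInf (e v) (hnb v)
    rw [← hen v] at hej
    refine ⟨v, j, ⟨hj, ?_⟩, Or.inl rfl⟩
    rintro u ⟨p, hp⟩ w hw
    rw [hej] at hp ⊢
    rw [hde u w hw, h.eq_of_walk hde p hp]
    exact le_sup_left
  · rintro ⟨i, j, h, rfl | rfl⟩
    · exact h.nodeRegMin hde hen
    · exact (h.symm hsym).nodeRegMin hde hen
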